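/- arXiv:0905.3374 — 2 statements merged into one kernel-verified Lean document; each statement's English description precedes it below -/
import Mathlib

section
/- Let G_{2n+1} ≤ SH_{2n+1} be the subgroup of signed permutation matrices of determinant 1 generated by a = (1, 2n+1, 2n, …, n+2, −(n+1), …, −3, −2) and b = (2n+1, 1, 2, …, 2n) (in the column-vector notation where (ε₁σ(1), …, ε_mσ(m)) denotes the matrix with columns ε_j e_{σ(j)}). Then the order of G_{2n+1} is (2n+1)·2^{2n+1}. -/
/-- The signed permutation matrix `a = (1, 2n+1, 2n, …, n+2, −(n+1), …, −3, −2)`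
(column `j` is `ε_j e_{σ(j)}`), written with 0-based indices. -/
def Amat (n : ℕ) : Matrix (Fin (2*n+1)) (Fin (2*n+1)) ℤ := fun i j =>
  if (j : ℕ) = 0 then (if (i : ℕ) = 0 then 1 else 0)
  else if (i : ℕ) = 2*n+1 - (j : ℕ) then (if (j : ℕ) ≤ n then 1 else -1) else 0

/-- The cyclic permutation matrix `b = (2n+1, 1, 2, …, 2n)`, with 0-based indices:
column `j` is `e_{j-1 (mod 2n+1)}`. -/
def Bmat (n : ℕ) : Matrix (Fin (2*n+1)) (Fin (2*n+1)) ℤ := fun i j =>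
  if i = j - 1 then 1 else 0

/-- The signed permutation matrix sending `e_j` to `v_j e_{r j + k}`. -/
def affineSignedMatrix {A : Type*} [AddCommGroup A] [DecidableEq A] (r : ℤˣ) (k : A)
    (v : A → ℤˣ) : Matrix A A ℤ := fun i j => if i = r • j + k then (v j : ℤ) else 0

section AffineSignedMatrix

variable {A : Type*} [AddCommGroup A] [DecidableEq A]

theorem affineSignedMatrix_one : affineSignedMatrix 1 (0 : A) 1 = 1 := by
  ext i j
  simp [affineSignedMatrix, Matrix.one_apply]

theorem affineSignedMatrix_mul [Fintype A] (r r' : ℤˣ) (k k' : A) (v v' : A → ℤˣ) :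
    affineSignedMatrix r k v * affineSignedMatrix r' k' v' =
      affineSignedMatrix (r * r') (r • k' + k) (fun j => v (r' • j + k') * v' j) := by
  ext i j
  simp [affineSignedMatrix, Matrix.mul_apply, smul_add, mul_smul, add_assoc]

theorem affineSignedMatrix_inv_mul [Fintype A] (r : ℤˣ) (k : A) (v : A → ℤˣ) :
    affineSignedMatrix r⁻¹ (-(r⁻¹ • k)) (fun j => (v (r⁻¹ • (j - k)))⁻¹) *
      affineSignedMatrix r k v = 1 := by
  rw [affineSignedMatrix_mul, ← affineSignedMatrix_one]
  congr 1
  · simp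
  · simp
  · ext j
    simp [smul_smul]

theorem affineSignedMatrix_apply_eq {r r' : ℤˣ} {k k' : A} {v v' : A → ℤˣ}
    (h : affineSignedMatrix r k v = affineSignedMatrix r' k' v') (j : A) :
    r • j + k = r' • j + k' ∧ v j = v' j := by
  have hj := congrFun (congrFun h (r • j + k)) j
  by_cases hp : r • j + k = r' • j + k'
  · simp only [affineSignedMatrix, if_true, if_pos hp] at hj
    exact ⟨hp, Units.ext hj⟩
  · simp [affineSignedMatrix, if_neg hp] at hj

theorem affineSignedMatrix_inj {r r' : ℤˣ} {k k' : A} {v v' : A → ℤˣ} {x : A} (hx : x ≠ -x)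
    (h : affineSignedMatrix r k v = affineSignedMatrix r' k' v') :
    r = r' ∧ k = k' ∧ v = v' := by
  have hk : k = k' := by simpa using (affineSignedMatrix_apply_eq h 0).1
  refine ⟨?_, hk, funext fun j => (affineSignedMatrix_apply_eq h j).2⟩
  have hr := (affineSignedMatrix_apply_eq h x).1
  rw [hk, add_left_inj] at hr
  rcases Int.units_eq_one_or r with rfl | rfl <;> rcases Int.units_eq_one_or r' with rfl | rfl <;>
    simp_all [eq_comm]

variable [Fintype A] {G : Submonoid (Matrix A A ℤ)}

/-- The sign vectors whose diagonal matrix lies in `G`. -/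
def diagonalSigns (G : Submonoid (Matrix A A ℤ)) : Submonoid (A → ℤˣ) where
  carrier := {v | affineSignedMatrix 1 0 v ∈ G}
  one_mem' := by
    simp [affineSignedMatrix_one]
  mul_mem' {v w} hv hw := by
    have := G.mul_mem hv hw
    rw [affineSignedMatrix_mul] at this
    simpa [Pi.mul_def] using this

theorem mem_diagonalSigns {v : A → ℤˣ} :
    v ∈ diagonalSigns G ↔ affineSignedMatrix 1 0 v ∈ G := Iff.rfl

theorem mem_diagonalSigns_of_prod_eq_one
    (hG : ∀ k : A, (fun j => if j = k then 1 else -1) ∈ diagonalSigns G)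
    {v : A → ℤˣ} (hv : ∏ j, v j = 1) : v ∈ diagonalSigns G := by
  have key : v = ∏ k, fun j => if j = k then 1 else v k := by
    ext1 j
    rw [Finset.prod_apply]
    have : ∀ k, (if j = k then 1 else v k) = v k * (if j = k then v k else 1) := by
      intro k
      split_ifs <;> simp
    rw [Finset.prod_congr rfl fun k _ => this k, Finset.prod_mul_distrib, hv]
    simp
  rw [key]
  refine Submonoid.prod_mem _ fun k _ => ?_
  rcases Int.units_eq_one_or (v k) with h | h
  · simp only [h, ite_self]
    exact (diagonalSigns G).one_mem
  · simpa [h] using hG k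

theorem affineSignedMatrix_mem
    (htrans : ∀ k : A, affineSignedMatrix 1 k 1 ∈ G)
    {s : A → ℤˣ} (hs : affineSignedMatrix (-1) 0 s ∈ G)
    (hs' : ∀ j, s (-j) * s j = if j = 0 then 1 else -1)
    {r : ℤˣ} {k : A} {v : A → ℤˣ} (hv : r = 1 ∧ ∏ j, v j = 1 ∨ r = -1 ∧ ∏ j, v j = ∏ j, s j) :
    affineSignedMatrix r k v ∈ G := by
  have hsq : (fun j : A => if j = 0 then (1 : ℤˣ) else -1) ∈ diagonalSigns G := by
    have := G.mul_mem hs hs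
    rw [affineSignedMatrix_mul] at this
    simpa [mem_diagonalSigns, hs'] using this
  have hdiag : ∀ k : A, (fun j => if j = k then (1 : ℤˣ) else -1) ∈ diagonalSigns G := by
    intro k
    have := G.mul_mem (G.mul_mem (htrans k) hsq) (htrans (-k))
    rw [affineSignedMatrix_mul, affineSignedMatrix_mul] at this
    simpa [mem_diagonalSigns, add_neg_eq_zero] using this
  rcases hv with ⟨rfl, hv⟩ | ⟨rfl, hv⟩
  · have := G.mul_mem (htrans k) (mem_diagonalSigns_of_prod_eq_one hdiag hv)
    rw [affineSignedMatrix_mul] at this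
    simpa using this
  · have hw : ∏ j, (s * v) j = 1 := by
      simp [Finset.prod_mul_distrib, hv]
    have := G.mul_mem (G.mul_mem (htrans k) hs) (mem_diagonalSigns_of_prod_eq_one hdiag hw)
    rw [affineSignedMatrix_mul, affineSignedMatrix_mul] at this
    simpa [← mul_assoc] using this

end AffineSignedMatrix

/-- The matrices `e_j ↦ v_j e_{r j + k}` of determinant one with `∏ v_j = r ^ n`. -/
def affineSignedSubgroup (A : Type*) [AddCommGroup A] [DecidableEq A] [Fintype A] (n : ℕ) :
    Subgroup (Matrix.SpecialLinearGroup A ℤ) where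
  carrier := {g | ∃ r k v, ∏ j, v j = r ^ n ∧ (g : Matrix A A ℤ) = affineSignedMatrix r k v}
  one_mem' := ⟨1, 0, 1, by simp, by simp [affineSignedMatrix_one]⟩
  mul_mem' := by
    rintro g g' ⟨r, k, v, hv, hg⟩ ⟨r', k', v', hv', hg'⟩
    refine ⟨r * r', r • k' + k, fun j => v (r' • j + k') * v' j, ?_, by
      rw [Matrix.SpecialLinearGroup.coe_mul, hg, hg', affineSignedMatrix_mul]⟩
    rw [Finset.prod_mul_distrib, hv', mul_pow, ← hv]
    congr 1
    exact Equiv.prod_comp ((MulAction.toPerm r').trans (Equiv.addRight k')) v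
  inv_mem' := by
    rintro g ⟨r, k, v, hv, hg⟩
    refine ⟨r⁻¹, -(r⁻¹ • k), fun j => (v (r⁻¹ • (j - k)))⁻¹, ?_, ?_⟩
    · rw [Finset.prod_inv_distrib, inv_pow, ← hv]
      congr 1
      exact Equiv.prod_comp ((Equiv.subRight k).trans (MulAction.toPerm r⁻¹)) v
    · have h := affineSignedMatrix_inv_mul r k v
      rw [← hg] at h
      have hinv : (g : Matrix A A ℤ) * (g⁻¹ : Matrix.SpecialLinearGroup A ℤ) = 1 := by
        rw [← Matrix.SpecialLinearGroup.coe_mul, mul_inv_cancel,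
          Matrix.SpecialLinearGroup.coe_one]
      exact (left_inv_eq_right_inv h hinv).symm

/-- The signs of the columns of `Amat n`. -/
def AmatSign (n : ℕ) (j : Fin (2 * n + 1)) : ℤˣ := if (j : ℕ) ≤ n then 1 else -1

theorem Amat_eq (n : ℕ) : Amat n = affineSignedMatrix (-1) 0 (AmatSign n) := by
  ext i j
  have hj := j.2
  have hi : i = (-1 : ℤˣ) • j + 0 ↔ (i : ℕ) = (2 * n + 1 - j) % (2 * n + 1) := by
    rw [Units.neg_smul, one_smul, add_zero, Fin.ext_iff, Fin.val_neg']
  simp only [Amat, affineSignedMatrix, hi, AmatSign]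
  by_cases h0 : (j : ℕ) = 0
  · simp [h0]
  · rw [Nat.mod_eq_of_lt (by omega), if_neg h0]
    split_ifs <;> simp

theorem Bmat_eq (n : ℕ) : Bmat n = affineSignedMatrix 1 (-1) 1 := by
  ext i j
  simp [Bmat, affineSignedMatrix, sub_eq_add_neg]

theorem prod_AmatSign (n : ℕ) : ∏ j, AmatSign n j = (-1) ^ n := by
  simp only [AmatSign]
  rw [Fin.prod_univ_eq_prod_range (fun j => if j ≤ n then (1 : ℤˣ) else -1),
    show 2 * n + 1 = (n + 1) + n by ring, Finset.prod_range_add,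
    Finset.prod_eq_one (by intro x hx; rw [if_pos]; grind)]
  simp [show ∀ x, ¬ n + 1 + x ≤ n by intro x; omega]

theorem AmatSign_neg_mul (n : ℕ) (j : Fin (2 * n + 1)) :
    AmatSign n (-j) * AmatSign n j = if j = 0 then 1 else -1 := by
  have hj := j.2
  have hneg := Fin.val_neg' j
  simp only [AmatSign, Fin.ext_iff, Fin.val_zero]
  by_cases h0 : (j : ℕ) = 0
  · simp [hneg, h0]
  · rw [Nat.mod_eq_of_lt (by omega)] at hneg
    rw [if_neg h0]
    split_ifs <;> first | omega | simp

open scoped Fin.CommRing in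
theorem Fin.val_nsmul_one {m : ℕ} [NeZero m] (k : Fin m) : k.val • (1 : Fin m) = k :=
  (nsmul_one k.val).trans (Fin.cast_val_eq_self k)

theorem affineSignedMatrix_mem_map_closure {n : ℕ}
    {a b : Matrix.SpecialLinearGroup (Fin (2 * n + 1)) ℤ}
    (ha : (a : Matrix _ _ ℤ) = Amat n) (hb : (b : Matrix _ _ ℤ) = Bmat n) {r : ℤˣ}
    {k : Fin (2 * n + 1)} {v : Fin (2 * n + 1) → ℤˣ} (hv : ∏ j, v j = r ^ n) :
    affineSignedMatrix r k v ∈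
      (Subgroup.closure {a, b}).toSubmonoid.map Matrix.SpecialLinearGroup.coeMonoidHom := by
  refine affineSignedMatrix_mem (s := AmatSign n) ?_ ?_ (AmatSign_neg_mul n) ?_
  · have hpow : ∀ t : ℕ, Bmat n ^ t = affineSignedMatrix 1 (-(t • 1)) 1 := by
      intro t
      induction t with
      | zero => simp [affineSignedMatrix_one]
      | succ t ih =>
        rw [pow_succ, ih, Bmat_eq, affineSignedMatrix_mul]
        congr 1
        rw [one_smul, succ_nsmul]
        abel
    intro k
    refine ⟨b ^ (-k).val, Subgroup.pow_mem _ (Subgroup.subset_closure (by simp)) _, ?_⟩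
    rw [map_pow, Matrix.SpecialLinearGroup.coeMonoidHom_apply, hb, hpow, Fin.val_nsmul_one, neg_neg]
  · exact ⟨a, Subgroup.subset_closure (by simp), by
      rw [Matrix.SpecialLinearGroup.coeMonoidHom_apply, ha, Amat_eq]⟩
  · rw [prod_AmatSign]
    rcases Int.units_eq_one_or r with rfl | rfl
    · exact Or.inl ⟨rfl, by simpa using hv⟩
    · exact Or.inr ⟨rfl, hv⟩

theorem closure_le_affineSignedSubgroup {n : ℕ}
    {a b : Matrix.SpecialLinearGroup (Fin (2 * n + 1)) ℤ}
    (ha : (a : Matrix _ _ ℤ) = Amat n) (hb : (b : Matrix _ _ ℤ) = Bmat n) :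
    Subgroup.closure {a, b} ≤ affineSignedSubgroup (Fin (2 * n + 1)) n := by
  rw [Subgroup.closure_le]
  rintro g (rfl | rfl)
  · exact ⟨-1, 0, AmatSign n, prod_AmatSign n, by rw [ha, Amat_eq]⟩
  · exact ⟨1, -1, 1, by simp, by rw [hb, Bmat_eq]⟩

/-- The subgroup `G_{2n+1}` of determinant-1 signed permutation matrices generated by
`a` and `b` has order `(2n+1)·2^{2n+1}`. -/
theorem card_G (n : ℕ) (hn : 0 < n)
    (a b : Matrix.SpecialLinearGroup (Fin (2*n+1)) ℤ)
    (ha : (a : Matrix (Fin (2*n+1)) (Fin (2*n+1)) ℤ) = Amat n)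
    (hb : (b : Matrix (Fin (2*n+1)) (Fin (2*n+1)) ℤ) = Bmat n) :
    Nat.card (Subgroup.closure {a, b} :
      Subgroup (Matrix.SpecialLinearGroup (Fin (2*n+1)) ℤ)) = (2*n+1) * 2^(2*n+1) := by
  have hprod (w : Fin (2 * n + 1) → ℤˣ) :
      ∏ j, (∏ i, w i) ^ (n + 1) * w j = (∏ i, w i) ^ n := by
    rw [Finset.prod_mul_distrib, Finset.prod_const, Finset.card_univ, Fintype.card_fin, ← pow_mul,
      ← pow_succ, show (n + 1) * (2 * n + 1) + 1 = n + 2 * (n * n + n + 1) by ring, pow_add,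
      pow_mul, Int.units_sq, one_pow, mul_one]
  have hmem (p : Fin (2 * n + 1) × (Fin (2 * n + 1) → ℤˣ)) :=
    affineSignedMatrix_mem_map_closure ha hb (k := p.1) (hprod p.2)
  choose f hf hfp using hmem
  have hne : (1 : Fin (2 * n + 1)) ≠ -1 := by
    have h1 : ((1 : Fin (2 * n + 1)) : ℕ) = 1 := by
      rw [Fin.val_one', Nat.mod_eq_of_lt (by omega)]
    rw [Ne, Fin.ext_iff, Fin.val_neg', h1, Nat.mod_eq_of_lt (by omega)]
    omega
  have hbij : Function.Bijective
      (fun p => (⟨f p, hf p⟩ : (Subgroup.closure {a, b} : Subgroup _))) := by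
    constructor
    · rintro ⟨k, w⟩ ⟨k', w'⟩ h
      have h' := congrArg Matrix.SpecialLinearGroup.coeMonoidHom (congrArg Subtype.val h)
      simp only [hfp] at h'
      obtain ⟨hr, hk, hv⟩ := affineSignedMatrix_inj hne h'
      refine Prod.ext hk (funext fun j => ?_)
      simpa [hr] using congrFun hv j
    · rintro ⟨g, hg⟩
      obtain ⟨r, k, v, hv, hgv⟩ := closure_le_affineSignedSubgroup ha hb hg
      have hw : ∏ j, r ^ (n + 1) * v j = r := by
        rw [Finset.prod_mul_distrib, hv, Finset.prod_const, Finset.card_univ, Fintype.card_fin,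
          ← pow_mul, ← pow_add,
          show (n + 1) * (2 * n + 1) + n = 1 + 2 * (n * n + 2 * n) by ring, pow_add,
          pow_mul, Int.units_sq, one_pow, pow_one, mul_one]
      refine ⟨(k, fun j => r ^ (n + 1) * v j),
        Subtype.ext (Matrix.SpecialLinearGroup.coeMonoidHom_injective ?_)⟩
      rw [hfp, Matrix.SpecialLinearGroup.coeMonoidHom_apply, hgv]
      simp only [hw, ← mul_assoc, Int.units_mul_self, one_mul]
  rw [← Nat.card_congr (Equiv.ofBijective _ hbij)]
  simp
end

section
/- The map f : G_{2n+1} → D_{2(2n+1)} taking absolute values of matrix entries satisfies f(C(a)) = ⟨x⟩ and induces a surjective quandle homomorphism from R̃_{2n+1} = (G_{2n+1}, C(a), a) onto R_{2n+1} = (D_{2(2n+1)}, ⟨x⟩, x). Moreover each fiber of this homomorphism has the same cardinality 2ⁿ, so R̃_{2n+1} is an extension of R_{2n+1}. -/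
/-- The group `G_{2n+1}` generated by `a` and `b`. -/
def Gp (n : ℕ) (a b : Matrix.SpecialLinearGroup (Fin (2*n+1)) ℤ) :
    Subgroup (Matrix.SpecialLinearGroup (Fin (2*n+1)) ℤ) :=
  Subgroup.closure {a, b}

theorem mem_a (n : ℕ) (a b : Matrix.SpecialLinearGroup (Fin (2*n+1)) ℤ) : a ∈ Gp n a b :=
  Subgroup.subset_closure (Set.mem_insert _ _)

theorem mem_b (n : ℕ) (a b : Matrix.SpecialLinearGroup (Fin (2*n+1)) ℤ) : b ∈ Gp n a b :=
  Subgroup.subset_closure (Set.mem_insert_of_mem _ rfl)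

/-- The subgroup `H = C(a)` of `G_{2n+1}` (centralizer of `a` inside `G_{2n+1}`). -/
def Hc (n : ℕ) (a b : Matrix.SpecialLinearGroup (Fin (2*n+1)) ℤ) : Subgroup ↥(Gp n a b) :=
  (Subgroup.centralizer {a}).subgroupOf (Gp n a b)

/-- The subgroup `⟨x⟩` of the dihedral group `D_{2(2n+1)}`, `x = sr 0`. -/
def Kx (n : ℕ) : Subgroup (DihedralGroup (2*n+1)) :=
  Subgroup.zpowers (DihedralGroup.sr 0)

/-- The action of the dihedral group on the vertices of the regular `(2n+1)`-gon. -/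
def vertexAct (n : ℕ) : DihedralGroup (2*n+1) → Fin (2*n+1) → Fin (2*n+1)
  | .r i, j => (show ZMod (2*n+1) from j) - i
  | .sr i, j => i - (show ZMod (2*n+1) from j)

theorem vertexAct_one (n : ℕ) (j : Fin (2*n+1)) : vertexAct n 1 j = j := by
  change (show ZMod (2*n+1) from j) - 0 = j
  exact sub_zero _

theorem vertexAct_mul (n : ℕ) (g h : DihedralGroup (2*n+1)) (j : Fin (2*n+1)) :
    vertexAct n (g * h) j = vertexAct n g (vertexAct n h j) := by
  have key : ∀ k : ZMod (2*n+1), (vertexAct n (g * h) k : ZMod (2*n+1))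
      = vertexAct n g (vertexAct n h k) := by
    intro k
    rcases g with x | x <;> rcases h with y | y <;>
      simp only [DihedralGroup.r_mul_r, DihedralGroup.r_mul_sr, DihedralGroup.sr_mul_r,
        DihedralGroup.sr_mul_sr, vertexAct]
    · exact (by ring : k - (x + y) = k - y - x)
    · exact (by ring : y - x - k = y - k - x)
    · exact (by ring : x + y - k = x - (k - y))
    · exact (by ring : k - (y - x) = x - (y - k))
  exact key j

theorem vertexAct_injective {n : ℕ} (hn : 0 < n) : Function.Injective (vertexAct n) := by
  have h2 : (2 : ZMod (2*n+1)) ≠ 0 := by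
    intro h
    have h' : ((2 : ℕ) : ZMod (2*n+1)) = 0 := by exact_mod_cast h
    rw [ZMod.natCast_eq_zero_iff] at h'
    have := Nat.le_of_dvd (by norm_num) h'
    omega
  intro g h hgh
  have h0 : (vertexAct n g (0 : ZMod (2*n+1)) : ZMod (2*n+1)) = vertexAct n h (0 : ZMod (2*n+1)) :=
    congrFun hgh _
  have h1 : (vertexAct n g (1 : ZMod (2*n+1)) : ZMod (2*n+1)) = vertexAct n h (1 : ZMod (2*n+1)) :=
    congrFun hgh _
  rcases g with x | x <;> rcases h with y | y <;> simp only [vertexAct] at h0 h1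
  · exact congrArg _ (sub_right_injective h0)
  · have h0 : (0 : ZMod (2*n+1)) - x = y - 0 := h0
    have h1 : (1 : ZMod (2*n+1)) - x = y - 1 := h1
    exact absurd (by linear_combination h1 - h0) h2
  · have h0 : x - (0 : ZMod (2*n+1)) = 0 - y := h0
    have h1 : x - (1 : ZMod (2*n+1)) = 1 - y := h1
    exact absurd (by linear_combination h0 - h1) h2
  · exact congrArg _ (sub_left_injective h0)

/-- The signed permutation matrix sending `e_j` to `d_j e_{g j}`. -/
def signedMat (n : ℕ) (d : Fin (2*n+1) → ℤˣ) (g : DihedralGroup (2*n+1)) :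
    Matrix (Fin (2*n+1)) (Fin (2*n+1)) ℤ :=
  fun i j => if i = vertexAct n g j then (d j : ℤ) else 0

theorem signedMat_one (n : ℕ) : signedMat n 1 1 = 1 := by
  ext i j
  simp [signedMat, vertexAct_one, Matrix.one_apply]

theorem signedMat_mul (n : ℕ) (d e : Fin (2*n+1) → ℤˣ) (g h : DihedralGroup (2*n+1)) :
    signedMat n d g * signedMat n e h
      = signedMat n (fun j => d (vertexAct n h j) * e j) (g * h) := by
  ext i j
  simp [signedMat, Matrix.mul_apply, vertexAct_mul]

theorem signedMat_injective {n : ℕ} (hn : 0 < n) {d e : Fin (2*n+1) → ℤˣ}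
    {g h : DihedralGroup (2*n+1)} (H : signedMat n d g = signedMat n e h) : d = e ∧ g = h := by
  have hgh : g = h := by
    apply vertexAct_injective hn
    funext j
    by_contra hne
    have := congrFun (congrFun H (vertexAct n g j)) j
    simp [signedMat, hne] at this
  subst hgh
  refine ⟨?_, rfl⟩
  funext j
  have := congrFun (congrFun H (vertexAct n g j)) j
  simpa [signedMat, Units.val_inj] using this

/-- The signs of the entries of `Amat`. -/
def signA (n : ℕ) (j : Fin (2*n+1)) : ℤˣ := if (j : ℕ) ≤ n then 1 else -1

theorem Amat_eq_signedMat (n : ℕ) : Amat n = signedMat n (signA n) (.sr 0) := by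
  ext i j
  have hv : vertexAct n (.sr 0) j = 0 - j := rfl
  have hi := i.isLt
  have hj := j.isLt
  simp only [Amat, signedMat, signA, hv, Fin.ext_iff, Fin.val_sub, Fin.val_zero]
  by_cases h0 : (j : ℕ) = 0
  · simp [h0]
  · have : (2*n+1 - (j : ℕ) + 0) % (2*n+1) = 2*n+1 - (j : ℕ) := Nat.mod_eq_of_lt (by omega)
    rw [if_neg h0, this]
    split_ifs <;> simp

theorem Bmat_eq_signedMat (n : ℕ) : Bmat n = signedMat n 1 (.r 1) := by
  ext i j
  have hv : vertexAct n (.r 1) j = j - 1 := rfl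
  simp [Bmat, signedMat, hv]

theorem signA_mul_signA_neg (n : ℕ) (j : Fin (2*n+1)) :
    signA n (-j) * signA n j = if j = 0 then 1 else -1 := by
  have hj := j.isLt
  by_cases h0 : j = 0
  · simp [h0, signA]
  · have h0' : (j : ℕ) ≠ 0 := fun h => h0 (Fin.ext h)
    have : ((-j : Fin (2*n+1)) : ℕ) = 2*n+1 - (j : ℕ) := by
      rw [Fin.val_neg', Nat.mod_eq_of_lt (by omega)]
    rw [if_neg h0]
    simp only [signA, this]
    split_ifs <;> first | rfl | omega

theorem exists_eq_signedMat {n : ℕ} {a b : Matrix.SpecialLinearGroup (Fin (2*n+1)) ℤ}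
    (ha : (a : Matrix (Fin (2*n+1)) (Fin (2*n+1)) ℤ) = Amat n)
    (hb : (b : Matrix (Fin (2*n+1)) (Fin (2*n+1)) ℤ) = Bmat n)
    {M : Matrix.SpecialLinearGroup (Fin (2*n+1)) ℤ} (hM : M ∈ Gp n a b) :
    ∃ d g, (M : Matrix (Fin (2*n+1)) (Fin (2*n+1)) ℤ) = signedMat n d g := by
  induction hM using Subgroup.closure_induction with
  | mem x hx =>
    rcases hx with rfl | rfl
    · exact ⟨_, _, ha.trans (Amat_eq_signedMat n)⟩
    · exact ⟨_, _, hb.trans (Bmat_eq_signedMat n)⟩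
  | one => exact ⟨1, 1, by rw [signedMat_one]; rfl⟩
  | mul x y _ _ hx hy =>
    obtain ⟨d, g, hx⟩ := hx
    obtain ⟨e, h, hy⟩ := hy
    exact ⟨_, _, by rw [Matrix.SpecialLinearGroup.coe_mul, hx, hy, signedMat_mul]⟩
  | inv x _ hx =>
    obtain ⟨d, g, hx⟩ := hx
    refine ⟨fun j => (d (vertexAct n g⁻¹ j))⁻¹, g⁻¹, ?_⟩
    have h1 : (x : Matrix (Fin (2*n+1)) (Fin (2*n+1)) ℤ)
        * signedMat n (fun j => (d (vertexAct n g⁻¹ j))⁻¹) g⁻¹ = 1 := by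
      rw [hx, signedMat_mul, ← signedMat_one]
      congr 1
      · funext j
        simp
      · simp
    have h2 : ((x⁻¹ : Matrix.SpecialLinearGroup (Fin (2*n+1)) ℤ) :
        Matrix (Fin (2*n+1)) (Fin (2*n+1)) ℤ) * x = 1 := by
      rw [← Matrix.SpecialLinearGroup.coe_mul, inv_mul_cancel, Matrix.SpecialLinearGroup.coe_one]
    exact left_inv_eq_right_inv h2 h1

/-- The number of points in a fiber of the map of right coset spaces induced by a group
homomorphism `φ`, from `H` to `φ(H)`, is the index of `H ∩ ker φ` in `ker φ`. -/
theorem card_fiber_eq_index {G D : Type*} [Group G] [Group D] (φ : G →* D) (H : Subgroup G)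
    (K : Subgroup D) (hK : H.map φ = K)
    (F : Quotient (QuotientGroup.rightRel H) → Quotient (QuotientGroup.rightRel K))
    (hF : ∀ u, F (Quotient.mk _ u) = Quotient.mk _ (φ u)) (g : G) :
    Nat.card {p // F p = Quotient.mk (QuotientGroup.rightRel K) (φ g)}
      = (H.subgroupOf φ.ker).index := by
  subst hK
  rw [Subgroup.index, ← Nat.card_congr
    (QuotientGroup.quotientRightRelEquivQuotientLeftRel (H.subgroupOf φ.ker))]
  symm
  have hmul (e : φ.ker) : φ ((e : G) * g) = φ g := by rw [map_mul, e.2, one_mul]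
  refine Nat.card_eq_of_bijective (fun q => Quotient.liftOn q
    (fun e => (⟨Quotient.mk _ ((e : G) * g), by rw [hF, hmul]⟩ :
      {p // F p = Quotient.mk (QuotientGroup.rightRel (H.map φ)) (φ g)})) ?_) ⟨?_, ?_⟩
  · intro e e' h
    apply Subtype.ext
    apply Quotient.sound
    change QuotientGroup.rightRel _ _ _ at h
    change QuotientGroup.rightRel _ _ _
    rw [QuotientGroup.rightRel_apply] at h ⊢
    simpa [Subgroup.mem_subgroupOf, mul_assoc] using h
  · rintro ⟨e⟩ ⟨e'⟩ h
    apply Quotient.sound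
    have h := Quotient.exact (congrArg Subtype.val h)
    change QuotientGroup.rightRel _ _ _ at h
    change QuotientGroup.rightRel _ _ _
    rw [QuotientGroup.rightRel_apply] at h ⊢
    simpa [Subgroup.mem_subgroupOf, mul_assoc] using h
  · rintro ⟨⟨u⟩, hu⟩
    have h := Quotient.exact ((hF u).symm.trans hu)
    change QuotientGroup.rightRel _ _ _ at h
    rw [QuotientGroup.rightRel_apply] at h
    obtain ⟨k, hk, hku⟩ := h
    have hφ : φ (k * u * g⁻¹) = 1 := by simp [hku]
    refine ⟨Quotient.mk _ ⟨k * u * g⁻¹, hφ⟩, Subtype.ext (Quotient.sound ?_)⟩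
    change QuotientGroup.rightRel _ _ _
    rw [QuotientGroup.rightRel_apply]
    simpa using hk

theorem exists_hom_dihedral {n : ℕ} (hn : 0 < n)
    {a b : Matrix.SpecialLinearGroup (Fin (2*n+1)) ℤ}
    (ha : (a : Matrix (Fin (2*n+1)) (Fin (2*n+1)) ℤ) = Amat n)
    (hb : (b : Matrix (Fin (2*n+1)) (Fin (2*n+1)) ℤ) = Bmat n) :
    ∃ φ : ↥(Gp n a b) →* DihedralGroup (2*n+1), ∀ (M : ↥(Gp n a b)) (g : DihedralGroup (2*n+1)),
      φ M = g ↔ ∃ d, (M.1 : Matrix (Fin (2*n+1)) (Fin (2*n+1)) ℤ) = signedMat n d g := by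
  choose d g hM using fun M : ↥(Gp n a b) => exists_eq_signedMat ha hb M.2
  refine ⟨MonoidHom.mk' g fun M M' => ?_, fun M k => ⟨?_, ?_⟩⟩
  · have h := hM (M * M')
    rw [Subgroup.coe_mul, Matrix.SpecialLinearGroup.coe_mul, hM M, hM M', signedMat_mul] at h
    exact (signedMat_injective hn h).2.symm
  · rintro rfl
    exact ⟨_, hM M⟩
  · rintro ⟨e, he⟩
    exact (signedMat_injective hn ((hM M).symm.trans he)).2

theorem surjective_of_r_one_of_sr_zero {G : Type*} [Group G] {n : ℕ}
    (φ : G →* DihedralGroup (2*n+1)) {x y : G} (hx : φ x = .sr 0) (hy : φ y = .r 1) :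
    Function.Surjective φ := by
  have hr (i : ZMod (2*n+1)) : φ (y ^ i.val) = .r i := by
    rw [map_pow, hy, DihedralGroup.r_one_pow, ZMod.natCast_zmod_val]
  rintro (i | i)
  · exact ⟨_, hr i⟩
  · exact ⟨x * y ^ i.val, by rw [map_mul, hr, hx, DihedralGroup.sr_mul_r, zero_add]⟩

theorem mem_Kx_of_commute {n : ℕ} {g : DihedralGroup (2*n+1)} (h : g * .sr 0 = .sr 0 * g) :
    g ∈ Kx n := by
  have key : ∀ i : ZMod (2*n+1), -i = i → i = 0 := by
    intro i hi
    rcases ZMod.neg_eq_self_iff i |>.1 hi with h | h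
    · exact h
    · omega
  rcases g with i | i
  · have : i = 0 := key i (by simpa using h)
    subst this
    exact one_mem _
  · have : i = 0 := key i (by simpa using h)
    subst this
    exact Subgroup.mem_zpowers _

theorem mem_Hc_iff {n : ℕ} {a b : Matrix.SpecialLinearGroup (Fin (2*n+1)) ℤ} (M : ↥(Gp n a b)) :
    M ∈ Hc n a b ↔ M * ⟨a, mem_a n a b⟩ = ⟨a, mem_a n a b⟩ * M := by
  rw [Hc, Subgroup.mem_subgroupOf, Subgroup.mem_centralizer_singleton_iff, Subtype.ext_iff]
  simp [eq_comm]

theorem signedMat_commute_Amat_iff {n : ℕ} (hn : 0 < n) (d : Fin (2*n+1) → ℤˣ) :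
    signedMat n d 1 * Amat n = Amat n * signedMat n d 1 ↔ ∀ j, d (-j) = d j := by
  have hv (j) : vertexAct n (.sr 0) j = -j := zero_sub (show ZMod (2*n+1) from j)
  rw [Amat_eq_signedMat, signedMat_mul, signedMat_mul, one_mul, mul_one]
  simp only [vertexAct_one, hv]
  constructor
  · intro h j
    have := congrFun (signedMat_injective hn h).1 j
    simpa [mul_comm (signA n j)] using this
  · intro h
    simp only [h, mul_comm]

theorem exists_mem_Gp_eq_signedMat {n : ℕ} {a b : Matrix.SpecialLinearGroup (Fin (2*n+1)) ℤ}
    (ha : (a : Matrix (Fin (2*n+1)) (Fin (2*n+1)) ℤ) = Amat n)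
    (hb : (b : Matrix (Fin (2*n+1)) (Fin (2*n+1)) ℤ) = Bmat n) (k : Fin (2*n+1)) :
    ∃ M : ↥(Gp n a b), (M.1 : Matrix (Fin (2*n+1)) (Fin (2*n+1)) ℤ)
      = signedMat n (fun j => if j = k then 1 else -1) 1 := by
  have hv (j) : vertexAct n (.sr 0) j = -j := zero_sub (show ZMod (2*n+1) from j)
  have hr (i j) : vertexAct n (.r i) j = j - (show Fin (2*n+1) from i) := rfl
  have hpow (m : ℕ) : (b : Matrix (Fin (2*n+1)) (Fin (2*n+1)) ℤ) ^ m
      = signedMat n 1 (.r (m : ZMod (2*n+1))) := by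
    induction m with
    | zero => rw [pow_zero, ← signedMat_one, Nat.cast_zero]; rfl
    | succ m ih =>
      rw [pow_succ, ih, hb, Bmat_eq_signedMat, signedMat_mul]
      simp [Pi.one_def]
  let κ : ZMod (2*n+1) := k
  let A : ↥(Gp n a b) := ⟨a, mem_a n a b⟩
  let B : ↥(Gp n a b) := ⟨b, mem_b n a b⟩
  refine ⟨B ^ (-κ).val * (A * A) * B ^ κ.val, ?_⟩
  have hM : ((B ^ (-κ).val * (A * A) * B ^ κ.val).1 : Matrix (Fin (2*n+1)) (Fin (2*n+1)) ℤ)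
      = (b : Matrix (Fin (2*n+1)) (Fin (2*n+1)) ℤ) ^ (-κ).val * (Amat n * Amat n)
        * (b : Matrix (Fin (2*n+1)) (Fin (2*n+1)) ℤ) ^ κ.val := by
    simp [A, B, ha]
  rw [hM, hpow, hpow, ZMod.natCast_zmod_val, ZMod.natCast_zmod_val, Amat_eq_signedMat]
  simp only [signedMat_mul, hv, Pi.one_apply, one_mul, mul_one, signA_mul_signA_neg, hr]
  congr 1
  · funext j
    exact if_congr sub_eq_zero rfl rfl
  · simp only [DihedralGroup.sr_mul_sr, DihedralGroup.r_mul_r, DihedralGroup.one_def]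
    congr 1
    ring

theorem index_Hc_subgroupOf_ker {n : ℕ} (hn : 0 < n)
    {a b : Matrix.SpecialLinearGroup (Fin (2*n+1)) ℤ}
    (ha : (a : Matrix (Fin (2*n+1)) (Fin (2*n+1)) ℤ) = Amat n)
    (hb : (b : Matrix (Fin (2*n+1)) (Fin (2*n+1)) ℤ) = Bmat n)
    (φ : ↥(Gp n a b) →* DihedralGroup (2*n+1))
    (hφ : ∀ (M : ↥(Gp n a b)) (g : DihedralGroup (2*n+1)),
      φ M = g ↔ ∃ d, (M.1 : Matrix (Fin (2*n+1)) (Fin (2*n+1)) ℤ) = signedMat n d g) :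
    ((Hc n a b).subgroupOf φ.ker).index = 2^n := by
  choose d hd using fun e : φ.ker => (hφ e.1 1).1 e.2
  have d_mul (e e' : φ.ker) : d (e * e') = d e * d e' := by
    have h := hd (e * e')
    rw [Subgroup.coe_mul, Subgroup.coe_mul, Matrix.SpecialLinearGroup.coe_mul, hd e, hd e',
      signedMat_mul] at h
    rw [← (signedMat_injective hn h).1]
    funext j
    simp [vertexAct_one]
  let p (i : Fin n) : Fin (2*n+1) := ⟨i + 1, by omega⟩
  have p_neg (i : Fin n) : ((-(p i) : Fin (2*n+1)) : ℕ) = 2*n - i := by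
    rw [Fin.val_neg', Nat.mod_eq_of_lt] <;> simp only [p] <;> omega
  let χ : φ.ker →* (Fin n → ℤˣ) := MonoidHom.mk' (fun e i => d e (-(p i)) * d e (p i)) (by
    intro e e'
    funext i
    simp only [d_mul, Pi.mul_apply]
    exact mul_mul_mul_comm _ _ _ _)
  have hker : χ.ker = (Hc n a b).subgroupOf φ.ker := by
    ext e
    have hcomm : e.1 ∈ Hc n a b ↔ ∀ j, d e (-j) = d e j := by
      rw [mem_Hc_iff, ← signedMat_commute_Amat_iff hn, ← hd e, ← ha,
        ← Matrix.SpecialLinearGroup.coe_mul, ← Matrix.SpecialLinearGroup.coe_mul, Subtype.ext_iff]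
      exact Subtype.ext_iff
    rw [Subgroup.mem_subgroupOf, hcomm, MonoidHom.mem_ker]
    have hχ : χ e = 1 ↔ ∀ i, d e (-(p i)) = d e (p i) := by
      rw [funext_iff]
      refine forall_congr' fun i => ?_
      change d e (-(p i)) * d e (p i) = 1 ↔ _
      rw [mul_eq_one_iff_eq_inv, Int.units_inv_eq_self]
    rw [hχ]
    refine ⟨fun h j => ?_, fun h i => h _⟩
    have hj := j.isLt
    by_cases h0 : (j : ℕ) = 0
    · have : j = 0 := Fin.ext h0
      simp [this]
    by_cases hjn : (j : ℕ) ≤ n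
    · have : p ⟨j - 1, by omega⟩ = j := Fin.ext (by simp only [p]; omega)
      simpa [this] using h ⟨j - 1, by omega⟩
    · have : -p ⟨2*n - j, by omega⟩ = j := Fin.ext (by rw [p_neg]; simp only; omega)
      have h' := h ⟨2*n - j, by omega⟩
      rw [this, neg_eq_iff_eq_neg.1 this] at h'
      exact h'.symm
  have hrange : χ.range = ⊤ := by
    refine eq_top_iff.2 fun s _ => Subgroup.pi_mem_of_mulSingle_mem s fun i => ?_
    rcases Int.units_eq_one_or (s i) with hs | hs
    · rw [hs, Pi.mulSingle_one]
      exact one_mem _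
    · obtain ⟨M, hM⟩ := exists_mem_Gp_eq_signedMat ha hb (p i)
      refine ⟨⟨M, (hφ M 1).2 ⟨_, hM⟩⟩, ?_⟩
      have hdM := (signedMat_injective hn ((hd ⟨M, (hφ M 1).2 ⟨_, hM⟩⟩).symm.trans hM)).1
      funext l
      change d _ (-(p l)) * d _ (p l) = _
      rw [hdM, hs]
      have h1 : -(p l) ≠ p i := by
        intro h
        have := congrArg Fin.val h
        rw [p_neg] at this
        simp only [p] at this
        omega
      have h2 : p l = p i ↔ l = i := by simp [p, Fin.ext_iff]
      by_cases hl : l = i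
      · subst hl
        simp [h1]
      · simp [h1, h2, hl]
  rw [← hker, Subgroup.index_ker, hrange, Subgroup.card_top]
  simp

/-- The absolute-value map induces a surjective quandle homomorphism from the coset
quandle `R̃_{2n+1} = (G_{2n+1}, C(a), a)` onto `R_{2n+1} = (D_{2(2n+1)}, ⟨x⟩, x)`:
there is a surjective group homomorphism `φ : G_{2n+1} → D_{2(2n+1)}` with `φ a = x`,
`φ b = y`, `φ(C(a)) = ⟨x⟩`, inducing a surjective map `F` of coset quandles respecting
the quandle operations `Hu ◁ Hv = H u v⁻¹ a v`, all of whose fibers have `2ⁿ` elements. -/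
theorem tilde_R_extension (n : ℕ) (hn : 0 < n)
    (a b : Matrix.SpecialLinearGroup (Fin (2*n+1)) ℤ)
    (ha : (a : Matrix (Fin (2*n+1)) (Fin (2*n+1)) ℤ) = Amat n)
    (hb : (b : Matrix (Fin (2*n+1)) (Fin (2*n+1)) ℤ) = Bmat n) :
    ∃ (φ : ↥(Gp n a b) →* DihedralGroup (2*n+1))
      (F : Quotient (QuotientGroup.rightRel (Hc n a b)) →
        Quotient (QuotientGroup.rightRel (Kx n))),
      φ ⟨a, mem_a n a b⟩ = DihedralGroup.sr 0 ∧
      φ ⟨b, mem_b n a b⟩ = DihedralGroup.r 1 ∧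
      Function.Surjective φ ∧
      Subgroup.map φ (Hc n a b) = Kx n ∧
      (∀ u : ↥(Gp n a b),
        F (Quotient.mk (QuotientGroup.rightRel (Hc n a b)) u)
          = Quotient.mk (QuotientGroup.rightRel (Kx n)) (φ u)) ∧
      (∀ u v : ↥(Gp n a b),
        F (Quotient.mk (QuotientGroup.rightRel (Hc n a b)) (u * v⁻¹ * ⟨a, mem_a n a b⟩ * v))
          = Quotient.mk (QuotientGroup.rightRel (Kx n))
              (φ u * (φ v)⁻¹ * DihedralGroup.sr 0 * φ v)) ∧
      Function.Surjective F ∧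
      (∀ q : Quotient (QuotientGroup.rightRel (Kx n)),
        Nat.card {p : Quotient (QuotientGroup.rightRel (Hc n a b)) // F p = q} = 2^n) := by
  obtain ⟨φ, hφ⟩ := exists_hom_dihedral hn ha hb
  have hφa : φ ⟨a, mem_a n a b⟩ = .sr 0 := (hφ _ _).2 ⟨_, ha.trans (Amat_eq_signedMat n)⟩
  have hφb : φ ⟨b, mem_b n a b⟩ = .r 1 := (hφ _ _).2 ⟨_, hb.trans (Bmat_eq_signedMat n)⟩
  have hsurj : Function.Surjective φ := surjective_of_r_one_of_sr_zero φ hφa hφb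
  have hmap : Subgroup.map φ (Hc n a b) = Kx n := by
    apply le_antisymm
    · rintro _ ⟨h, hh, rfl⟩
      apply mem_Kx_of_commute
      have := congrArg φ ((mem_Hc_iff h).1 hh)
      rwa [map_mul, map_mul, hφa] at this
    · rw [Kx, Subgroup.zpowers_le]
      exact ⟨_, (mem_Hc_iff _).2 rfl, hφa⟩
  let F : Quotient (QuotientGroup.rightRel (Hc n a b)) → Quotient (QuotientGroup.rightRel (Kx n)) :=
    Quotient.map φ fun u v huv => by
      change QuotientGroup.rightRel _ _ _ at huv
      change QuotientGroup.rightRel _ _ _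
      rw [QuotientGroup.rightRel_apply] at huv ⊢
      rw [← map_inv, ← map_mul, ← hmap]
      exact Subgroup.mem_map_of_mem φ huv
  have hF : ∀ u, F (Quotient.mk _ u) = Quotient.mk _ (φ u) := fun _ => rfl
  refine ⟨φ, F, hφa, hφb, hsurj, hmap, hF, fun u v => ?_, ?_, ?_⟩
  · rw [hF, map_mul, map_mul, map_mul, map_inv, hφa]
  · rintro ⟨x⟩
    obtain ⟨u, rfl⟩ := hsurj x
    exact ⟨Quotient.mk _ u, hF u⟩
  · rintro ⟨x⟩
    obtain ⟨g, rfl⟩ := hsurj x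
    exact (card_fiber_eq_index φ _ _ hmap F hF g).trans (index_Hc_subgroupOf_ker hn ha hb φ hφ)
end
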